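/- Let 𝒰 be a non-principal (free) ultrafilter on ℕ. Then 𝒰, viewed as a filter, does not admit an ω^ω-base: there is no map V from ℕ → ℕ (with the pointwise partial order) to subsets of ℕ such that V(f) ∈ 𝒰 for all f, f ≤ g implies V(g) ⊆ V(f), and every member of 𝒰 contains some V(f). -/

import Mathlib

/-- A filter `F` admits an `ω^ω`-base if there is a monotone cofinal map from
`ℕ → ℕ` (with the pointwise order) to the members of `F`. -/
def HasOmegaOmegaBase {X : Type*} (F : Filter X) : Prop :=
  ∃ V : (ℕ → ℕ) → Set X, (∀ f, V f ∈ F) ∧ (∀ f g : ℕ → ℕ, f ≤ g → V g ⊆ V f) ∧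
    ∀ A ∈ F, ∃ f, V f ⊆ A

/-- A family of sets that is decreasing in `f : ℕ → ℕ` generates an analytic subset of the
Cantor space. -/
theorem analyticSet_setOf_exists_subset {V : (ℕ → ℕ) → Set ℕ}
    (hV : ∀ f g : ℕ → ℕ, f ≤ g → V g ⊆ V f) :
    MeasureTheory.AnalyticSet {x : ℕ → Bool | ∃ f, V f ⊆ {n | x n = true}} := by
  let C : Set ((ℕ → ℕ) × (ℕ → Bool)) :=
    {p | ∀ n, ∃ g, (∀ i : Fin n, g i = p.1 i) ∧ ∀ i : Fin n, (i : ℕ) ∈ V g → p.2 i = true}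
  have hC : IsClosed C := by
    have hC' : C = ⋂ n, {p | ∃ g, (∀ i : Fin n, g i = p.1 i) ∧
        ∀ i : Fin n, (i : ℕ) ∈ V g → p.2 i = true} := by
      ext p
      simp [C]
    rw [hC']
    refine isClosed_iInter fun n => ?_
    have hcont : Continuous fun p : (ℕ → ℕ) × (ℕ → Bool) =>
        ((fun i : Fin n => p.1 i, fun i : Fin n => p.2 i) : (Fin n → ℕ) × (Fin n → Bool)) := by
      fun_prop
    exact (isClosed_discrete {q : (Fin n → ℕ) × (Fin n → Bool) | ∃ g : ℕ → ℕ,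
      (∀ i : Fin n, g i = q.1 i) ∧ ∀ i : Fin n, (i : ℕ) ∈ V g → q.2 i = true}).preimage hcont
  have himage : {x : ℕ → Bool | ∃ f, V f ⊆ {n | x n = true}} = Prod.snd '' C := by
    ext x
    constructor
    · rintro ⟨f, hf⟩
      exact ⟨(f, x), fun n => ⟨f, fun _ => rfl, fun i hi => hf hi⟩, rfl⟩
    · rintro ⟨⟨f, y⟩, hp, rfl⟩
      choose g hgf hgV using hp
      let G : ℕ → ℕ := fun i => max (f i) ((Finset.range (i + 1)).sup fun n => g n i)
      have hG : ∀ n, g n ≤ G := by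
        intro n i
        by_cases h : i < n
        · exact (hgf n ⟨i, h⟩).le.trans (le_max_left _ _)
        · exact le_max_of_le_right
            (Finset.le_sup (f := fun n => g n i) (Finset.mem_range.2 (by omega)))
      exact ⟨G, fun i hi => hgV (i + 1) ⟨i, by omega⟩ (hV _ _ (hG (i + 1)) hi)⟩
  rw [himage]
  have : SecondCountableTopology Bool := Finite.toSecondCountableTopology
  exact hC.analyticSet.image_of_continuous continuous_snd

/-- Negate all coordinates of a binary sequence from the index `k` on. -/
def flipFrom (k : ℕ) (x : ℕ → Bool) : ℕ → Bool := fun n => if n < k then x n else !x n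

theorem flipFrom_flipFrom (k : ℕ) (x : ℕ → Bool) : flipFrom k (flipFrom k x) = x := by
  funext n
  by_cases h : n < k <;> simp [flipFrom, h]

theorem continuous_flipFrom (k : ℕ) : Continuous (flipFrom k) := by
  refine continuous_pi fun n => ?_
  by_cases h : n < k
  · simpa [flipFrom, h] using continuous_apply n
  · simpa [flipFrom, h, Function.comp_def] using
      (continuous_of_discreteTopology (f := not)).comp (continuous_apply (A := fun _ : ℕ => Bool) n)

/-- `flipFrom k` as a self-homeomorphism of the Cantor space. -/
def flipFromHomeomorph (k : ℕ) : (ℕ → Bool) ≃ₜ (ℕ → Bool) where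
  toFun := flipFrom k
  invFun := flipFrom k
  left_inv := flipFrom_flipFrom k
  right_inv := flipFrom_flipFrom k
  continuous_toFun := continuous_flipFrom k
  continuous_invFun := continuous_flipFrom k

theorem flipFrom_mem_iff {U : Ultrafilter ℕ} (hU : ∀ A ∈ U, A.Infinite) (k : ℕ) (x : ℕ → Bool) :
    {n | flipFrom k x n = true} ∈ U ↔ {n | x n = true} ∉ U := by
  have hk : {n | k ≤ n} ∈ U := by
    by_contra h
    refine hU _ (Ultrafilter.compl_mem_iff_notMem.2 h) ((Set.finite_lt_nat k).subset ?_)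
    intro n hn
    simpa using hn
  rw [← Ultrafilter.compl_mem_iff_notMem]
  refine Filter.congr_sets (f := (U : Filter ℕ)) (Filter.mem_of_superset hk fun n hn => ?_)
  have hn' : ¬ n < k := not_lt.2 hn
  change flipFrom k x n = true ↔ ¬ x n = true
  simp [flipFrom, hn']

/-- A free ultrafilter, as a subset of the Cantor space, is not Borel. -/
theorem not_measurableSet_setOf_mem_ultrafilter {U : Ultrafilter ℕ}
    (hU : ∀ A ∈ U, A.Infinite) :
    ¬ MeasurableSet {x : ℕ → Bool | {n | x n = true} ∈ U} := by
  intro hmeas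
  obtain ⟨W, hW, hWU⟩ := hmeas.residualEq_isOpen
  have hR : {x : ℕ → Bool | {n | x n = true} ∈ U ↔ x ∈ W} ∈ residual (ℕ → Bool) := by
    filter_upwards [hWU] with x hx
    exact iff_of_eq hx
  have hRk (k : ℕ) : {x : ℕ → Bool | ({n | x n = true} ∈ U ↔ x ∈ W) ∧
      ({n | flipFrom k x n = true} ∈ U ↔ flipFrom k x ∈ W)} ∈ residual (ℕ → Bool) :=
    Filter.inter_mem hR (tendsto_residual_of_isOpenMap (flipFromHomeomorph k).continuous
      (flipFromHomeomorph k).isOpenMap hR)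
  rcases W.eq_empty_or_nonempty with rfl | ⟨x, hx⟩
  · obtain ⟨y, hy, hy'⟩ := (dense_of_mem_residual (hRk 0)).nonempty
    rw [flipFrom_mem_iff hU] at hy'
    simp_all
  · obtain ⟨_, ⟨z, k, rfl⟩, hxk, hkW⟩ :=
      (PiNat.isTopologicalBasis_cylinders fun _ : ℕ => Bool).exists_subset_of_mem_open hx hW
    obtain ⟨y, hyk, hy, hy'⟩ := (dense_of_mem_residual (hRk k)).inter_open_nonempty _
      (PiNat.isOpen_cylinder _ z k) ⟨x, hxk⟩
    have hflip : flipFrom k y ∈ PiNat.cylinder z k := by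
      intro i hi
      simpa [flipFrom, hi] using hyk i hi
    exact (flipFrom_mem_iff hU k y).1 (hy'.2 (hkW hflip)) (hy.2 (hkW hyk))

/-- (From Example 3.23, after Solecki–Todorcevic): no non-principal (free) ultrafilter
on `ℕ` is Tukey-reducible to `ω^ω`; in particular no such ultrafilter admits an
`ω^ω`-base. -/
theorem stmt10 (U : Ultrafilter ℕ) (hU : ∀ A ∈ U, A.Infinite) :
    ¬ HasOmegaOmegaBase (U : Filter ℕ) := by
  rintro ⟨V, hVU, hV, hcof⟩
  have hset : {x : ℕ → Bool | ∃ f, V f ⊆ {n | x n = true}} =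
      {x : ℕ → Bool | {n | x n = true} ∈ U} := by
    ext x
    exact ⟨fun ⟨f, hf⟩ => Filter.mem_of_superset (hVU f) hf, fun hx => hcof _ hx⟩
  have hana := analyticSet_setOf_exists_subset hV
  rw [hset] at hana
  refine not_measurableSet_setOf_mem_ultrafilter hU (hana.measurableSet_of_compl ?_)
  have hcompl : {x : ℕ → Bool | {n | x n = true} ∈ U}ᶜ =
      flipFrom 0 '' {x : ℕ → Bool | {n | x n = true} ∈ U} := by
    ext x
    constructor
    · intro hx
      exact ⟨flipFrom 0 x, (flipFrom_mem_iff hU 0 x).2 hx, flipFrom_flipFrom 0 x⟩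
    · rintro ⟨y, hy, rfl⟩ hy'
      exact (flipFrom_mem_iff hU 0 y).1 hy' hy
  rw [hcompl]
  exact hana.image_of_continuous (continuous_flipFrom 0)
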